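/- Let d ≥ 2 and let F be a degree-d foliation of ℙ²(ℂ) given by Ω = p dx + q dy + r dz (p, q, r ∈ ℂ[x,y,z] homogeneous of degree d+1, xp + yq + zr = 0, gcd(p,q,r) = 1). Suppose F has three non-collinear radial singularities of maximal order d−1; concretely, suppose there exists S ∈ GL₃(ℂ) such that Ω' = S*Ω = p'dx + q'dy + r'dz satisfies: (i) p'(x,y,1) and q'(x,y,1) vanish at (0,0) and their linear parts there are not both zero, while r'(x,y,1) vanishes at (0,0) to order exactly d+1; (ii) p'(x,1,z) and r'(x,1,z) vanish at (0,0) with linear parts not both zero, while q'(x,1,z) vanishes at (0,0) to order exactly d+1; (iii) q'(1,y,z) and r'(1,y,z) vanish at (0,0) with linear parts not both zero, while p'(1,y,z) vanishes at (0,0) to order exactly d+1. Then F is linearly conjugate to the degree-d Fermat foliation: there exist T ∈ GL₃(ℂ) and λ ∈ ℂ* with T*Ω = λ·( x^d(y dz − z dy) + y^d(z dx − x dz) + z^d(x dy − y dx) ). -/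

import Mathlib

open MvPolynomial

noncomputable section

/-- The inclusion `ℂ[x,y] → ℂ[x,y,z]`. -/
def emb : MvPolynomial (Fin 2) ℂ →ₐ[ℂ] MvPolynomial (Fin 3) ℂ :=
  rename Fin.castSucc

/-- The homogeneous projective 1-form
`Ω = (zA − yC) dx + (zB + xC) dy − (xA + yB) dz`
associated to the affine 1-form `ω = A dx + B dy + C (x dy − y dx)` of a degree-3
foliation with a singular point of algebraic multiplicity 3 at the origin
(`A`, `B`, `C` homogeneous of degree 3). -/
def OmABC (A B Cc : MvPolynomial (Fin 2) ℂ) : Fin 3 → MvPolynomial (Fin 3) ℂ :=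
  ![X 2 * emb A - X 1 * emb Cc,
    X 2 * emb B + X 0 * emb Cc,
    -(X 0 * emb A + X 1 * emb B)]

/-- Substitution of the linear change of variables on `ℂ³` given by the matrix `M`. -/
def subst3 (M : Matrix (Fin 3) (Fin 3) ℂ) (P : MvPolynomial (Fin 3) ℂ) :
    MvPolynomial (Fin 3) ℂ :=
  aeval (fun i => ∑ j, C (M i j) * X j) P

/-- Pullback of the 1-form with coefficient vector `Ω` by the linear map of matrix `M`. -/
def pb3 (M : Matrix (Fin 3) (Fin 3) ℂ) (Ω : Fin 3 → MvPolynomial (Fin 3) ℂ) :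
    Fin 3 → MvPolynomial (Fin 3) ℂ :=
  fun i => ∑ j, C (M j i) * subst3 M (Ω j)

/-- Two projective 1-forms are linearly conjugate: `T*Ω = c·Ω'` for some
`T ∈ GL₃(ℂ)` and `c ∈ ℂ*`. -/
def LinConj3 (Ω Ω' : Fin 3 → MvPolynomial (Fin 3) ℂ) : Prop :=
  ∃ (M : Matrix (Fin 3) (Fin 3) ℂ) (c : ℂ), IsUnit M.det ∧ c ≠ 0 ∧
    pb3 M Ω = fun i => C c * Ω' i

/-- Dehomogenization in the chart `z = 1`. -/
def dhz : MvPolynomial (Fin 3) ℂ →ₐ[ℂ] MvPolynomial (Fin 2) ℂ :=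
  aeval (![X 0, X 1, 1] : Fin 3 → MvPolynomial (Fin 2) ℂ)

/-- Dehomogenization in the chart `y = 1` (chart coordinates `(x, z)`). -/
def dhy : MvPolynomial (Fin 3) ℂ →ₐ[ℂ] MvPolynomial (Fin 2) ℂ :=
  aeval (![X 0, 1, X 1] : Fin 3 → MvPolynomial (Fin 2) ℂ)

/-- Dehomogenization in the chart `x = 1` (chart coordinates `(y, z)`). -/
def dhx : MvPolynomial (Fin 3) ℂ →ₐ[ℂ] MvPolynomial (Fin 2) ℂ :=
  aeval (![1, X 0, X 1] : Fin 3 → MvPolynomial (Fin 2) ℂ)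

/-- In a given affine chart, the origin is a radial singularity of maximal order
`d − 1`: the two 1-form coefficients `f`, `g` vanish at the origin with linear parts
not both zero, while the third coefficient `h` vanishes at the origin to order
exactly `d + 1`. -/
def radCond (d : ℕ) (f g h : MvPolynomial (Fin 2) ℂ) : Prop :=
  homogeneousComponent 0 f = 0 ∧ homogeneousComponent 0 g = 0 ∧
    (homogeneousComponent 1 f ≠ 0 ∨ homogeneousComponent 1 g ≠ 0) ∧
    (∀ k < d + 1, homogeneousComponent k h = 0) ∧
    homogeneousComponent (d + 1) h ≠ 0

/-- The Fermat 1-form `x^d(y dz − z dy) + y^d(z dx − x dz) + z^d(x dy − y dx)`. -/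
def FermatForm (d : ℕ) : Fin 3 → MvPolynomial (Fin 3) ℂ :=
  ![X 1 ^ d * X 2 - X 2 ^ d * X 1,
    X 2 ^ d * X 0 - X 0 ^ d * X 2,
    X 0 ^ d * X 1 - X 1 ^ d * X 0]

/-- drop the `k`-th exponent -/
def dropE (k : Fin 3) (s : Fin 3 →₀ ℕ) : Fin 2 →₀ ℕ :=
  Finsupp.equivFunOnFinite.symm (fun j => s (k.succAbove j))

lemma dropE_apply (k : Fin 3) (s : Fin 3 →₀ ℕ) (j : Fin 2) :
    dropE k s j = s (k.succAbove j) := rfl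

lemma dropE_degree (k : Fin 3) (s : Fin 3 →₀ ℕ) :
    s.degree = s k + (dropE k s).degree := by
  rw [Finsupp.degree_eq_sum, Finsupp.degree_eq_sum, Fin.sum_univ_succAbove _ k]
  rfl

lemma dropE_inj (k : Fin 3) (s t : Fin 3 →₀ ℕ) (h : dropE k s = dropE k t)
    (hd : s.degree = t.degree) : s = t := by
  have h2 := dropE_degree k s
  have h3 := dropE_degree k t
  rw [h] at h2
  ext l
  rcases Fin.eq_self_or_eq_succAbove k l with rfl | ⟨j, rfl⟩
  · omega
  · rw [← dropE_apply, h, dropE_apply]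

lemma dh_eq (k : Fin 3) (P : MvPolynomial (Fin 3) ℂ) :
    aeval (k.insertNth (α := fun _ => MvPolynomial (Fin 2) ℂ) 1 X) P
      = ∑ s ∈ P.support, monomial (dropE k s) (coeff s P) := by
  conv_lhs => rw [P.as_sum, map_sum]
  refine Finset.sum_congr rfl fun s _ => ?_
  rw [aeval_monomial, monomial_eq, Finsupp.prod_fintype _ _ (by simp),
    Finsupp.prod_fintype _ _ (by simp), Fin.prod_univ_succAbove _ k]
  simp [dropE_apply, algebraMap_eq]

lemma dh_coeff (k : Fin 3) (n : ℕ) (P : MvPolynomial (Fin 3) ℂ) (hP : P.IsHomogeneous n)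
    (m : Fin 3 →₀ ℕ) (hm : m.degree = n) :
    coeff (dropE k m) (aeval (k.insertNth (α := fun _ => MvPolynomial (Fin 2) ℂ) 1 X) P)
      = coeff m P := by
  rw [dh_eq, coeff_sum]
  simp only [coeff_monomial]
  rw [Finset.sum_eq_single m]
  · simp
  · intro s hs hne
    rw [if_neg]
    intro h
    refine hne (dropE_inj k s m h ?_)
    rw [hm]
    by_contra hc
    exact (mem_support_iff.1 hs) (hP.coeff_eq_zero hc)
  · intro h
    simpa using h

lemma dh_vanish (k : Fin 3) (n : ℕ) (P : MvPolynomial (Fin 3) ℂ) (hP : P.IsHomogeneous n)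
    (h : ∀ l < n, homogeneousComponent l
      (aeval (k.insertNth (α := fun _ => MvPolynomial (Fin 2) ℂ) 1 X) P) = 0)
    (m : Fin 3 →₀ ℕ) (hm : m k ≠ 0) : coeff m P = 0 := by
  by_cases hd : m.degree = n
  · rw [← dh_coeff k n P hP m hd]
    have h1 := dropE_degree k m
    have h2 := congrArg (coeff (dropE k m)) (h (dropE k m).degree (by omega))
    rw [coeff_homogeneousComponent, if_pos rfl] at h2
    simpa using h2
  · exact hP.coeff_eq_zero hd

lemma dhz_eq : dhz = aeval ((2 : Fin 3).insertNth (α := fun _ => MvPolynomial (Fin 2) ℂ) 1 X) := by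
  unfold dhz; congr 1; ext1 i; fin_cases i <;> rfl
lemma dhy_eq : dhy = aeval ((1 : Fin 3).insertNth (α := fun _ => MvPolynomial (Fin 2) ℂ) 1 X) := by
  unfold dhy; congr 1; ext1 i; fin_cases i <;> rfl
lemma dhx_eq : dhx = aeval ((0 : Fin 3).insertNth (α := fun _ => MvPolynomial (Fin 2) ℂ) 1 X) := by
  unfold dhx; congr 1; ext1 i; fin_cases i <;> rfl

/-- coefficient of `x_j^d x_k` -/
def cf (d : ℕ) (P : MvPolynomial (Fin 3) ℂ) (j k : Fin 3) : ℂ :=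
  coeff (Finsupp.single j d + Finsupp.single k 1) P

lemma fin3_all : ∀ i j k : Fin 3, i ≠ j → j ≠ k → i ≠ k → ∀ l, l = i ∨ l = j ∨ l = k := by
  decide

lemma fin3_univ : ∀ i j k : Fin 3, i ≠ j → j ≠ k → i ≠ k → Finset.univ = {i, j, k} := by
  decide

lemma struct_rel (d : ℕ) (hd : 2 ≤ d) (P : Fin 3 → MvPolynomial (Fin 3) ℂ)
    (hv : ∀ i m, m i ≠ 0 → coeff m (P i) = 0)
    (i j k : Fin 3) (hij : i ≠ j) (hjk : j ≠ k) (hik : i ≠ k)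
    (he : X i * P i + X j * P j + X k * P k = 0) :
    cf d (P i) j k = - cf d (P k) j i := by
  have h := congrArg (coeff (Finsupp.single i 1 + (Finsupp.single j d + Finsupp.single k 1))) he
  rw [coeff_add, coeff_add, coeff_X_mul, coeff_X_mul' _ j, coeff_zero,
    show (Finsupp.single i 1 + (Finsupp.single j d + Finsupp.single k 1) : Fin 3 →₀ ℕ)
      = Finsupp.single k 1 + (Finsupp.single j d + Finsupp.single i 1) by abel,
    coeff_X_mul, hv j] at h
  · simp only [ite_self] at h
    unfold cf
    linear_combination h
  · simp [hij, hjk.symm, hij.symm, hjk]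
    omega

lemma struct_form (d : ℕ) (hd : 2 ≤ d) (P : Fin 3 → MvPolynomial (Fin 3) ℂ)
    (hP : ∀ i, (P i).IsHomogeneous (d + 1))
    (hv : ∀ i m, m i ≠ 0 → coeff m (P i) = 0)
    (i j k : Fin 3) (hij : i ≠ j) (hjk : j ≠ k) (hik : i ≠ k)
    (he : X i * P i + X j * P j + X k * P k = 0) :
    P i = C (cf d (P i) j k) * (X j ^ d * X k) + C (cf d (P i) k j) * (X k ^ d * X j) := by
  have e : ∀ j k : Fin 3, ∀ a : ℂ, C a * (X j ^ d * X k) =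
      monomial (Finsupp.single j d + Finsupp.single k 1) a := by
    intro j k a
    rw [X_pow_eq_monomial, X, monomial_mul, C_mul_monomial]
    simp
  rw [e, e]
  ext m
  rw [coeff_add, coeff_monomial, coeff_monomial]
  by_cases h1 : Finsupp.single j d + Finsupp.single k 1 = m
  · rw [if_pos h1, if_neg, ← h1]
    · simp [cf]
    · rintro rfl
      have := DFunLike.congr_fun h1 j
      simp [hjk, hjk.symm] at this
      omega
  rw [if_neg h1]
  by_cases h2 : Finsupp.single k d + Finsupp.single j 1 = m
  · rw [if_pos h2, ← h2]
    simp [cf]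
  rw [if_neg h2, add_zero]
  by_cases hm : m i = 0
  swap
  · exact hv i m hm
  by_cases hdeg : m.degree = d + 1
  swap
  · exact (hP i).coeff_eq_zero hdeg
  have hs : m i + (m j + m k) = d + 1 := by
    rw [← hdeg, Finsupp.degree_eq_sum, fin3_univ i j k hij hjk hik]
    rw [Finset.sum_insert (by simp [hij, hik]), Finset.sum_insert (by simp [hjk]),
      Finset.sum_singleton]
  have hk1 : m k ≠ 1 := by
    intro hk
    apply h1
    ext l
    rcases fin3_all i j k hij hjk hik l with rfl | rfl | rfl
    · simp [hm, hij, hik]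
    · simp [hjk]; omega
    · simp [hjk.symm, hk]
  have hj1 : m j ≠ 1 := by
    intro hj
    apply h2
    ext l
    rcases fin3_all i j k hij hjk hik l with rfl | rfl | rfl
    · simp [hm, hij, hik]
    · simp [hjk, hj]
    · simp [hjk.symm]; omega
  have h := congrArg (coeff (Finsupp.single i 1 + m)) he
  rw [coeff_add, coeff_add, coeff_X_mul, coeff_X_mul' _ j, coeff_X_mul' _ k, coeff_zero] at h
  have z : ∀ l, i ≠ l → m l ≠ 1 → (if l ∈ (Finsupp.single i 1 + m).support then
      coeff (Finsupp.single i 1 + m - Finsupp.single l 1) (P l) else 0) = 0 := by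
    intro l hl h1
    split_ifs with hmem
    · apply hv
      simp [hl, hl.symm] at hmem ⊢
      omega
    · rfl
  rw [z j hij hj1, z k hik hk1] at h
  simpa using h

lemma comp_one_zero (d : ℕ) (hd : 2 ≤ d) (a : ℂ) (i : Fin 2) :
    homogeneousComponent 1 (C a * X i ^ d) = 0 := by
  rw [homogeneousComponent_of_mem (n := d), if_neg (by omega)]
  rw [mem_homogeneousSubmodule]
  have := (isHomogeneous_C (Fin 2) a).mul (isHomogeneous_X_pow (R := ℂ) i d)
  simpa using this

lemma subst3_hom (M : Matrix (Fin 3) (Fin 3) ℂ) (n : ℕ) (P : MvPolynomial (Fin 3) ℂ)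
    (hP : P.IsHomogeneous n) : (subst3 M P).IsHomogeneous n := by
  have := hP.aeval (fun i => ∑ j, C (M i j) * X j : Fin 3 → MvPolynomial (Fin 3) ℂ) (n := 1)
    (fun i => IsHomogeneous.sum _ _ _ fun j _ => by
      simpa using (isHomogeneous_C (Fin 3) (M i j)).mul (isHomogeneous_X ℂ j))
  simpa [subst3] using this

lemma pb3_hom (M : Matrix (Fin 3) (Fin 3) ℂ) (n : ℕ) (P : Fin 3 → MvPolynomial (Fin 3) ℂ)
    (hP : ∀ i, (P i).IsHomogeneous n) (i : Fin 3) : (pb3 M P i).IsHomogeneous n := by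
  refine IsHomogeneous.sum _ _ _ fun j _ => ?_
  simpa using (isHomogeneous_C (Fin 3) (M j i)).mul (subst3_hom M n _ (hP j))

lemma pb3_euler (M : Matrix (Fin 3) (Fin 3) ℂ) (P : Fin 3 → MvPolynomial (Fin 3) ℂ)
    (he : X 0 * P 0 + X 1 * P 1 + X 2 * P 2 = 0) :
    X 0 * pb3 M P 0 + X 1 * pb3 M P 1 + X 2 * pb3 M P 2 = 0 := by
  have h := congrArg (aeval (fun i => ∑ j, C (M i j) * X j : Fin 3 → MvPolynomial (Fin 3) ℂ)) he
  simp only [map_add, map_mul, aeval_X, map_zero, Fin.sum_univ_three] at h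
  simp only [pb3, subst3, Fin.sum_univ_three]
  linear_combination h

lemma subst3_mul (M N : Matrix (Fin 3) (Fin 3) ℂ) (Q : MvPolynomial (Fin 3) ℂ) :
    subst3 (M * N) Q = subst3 N (subst3 M Q) := by
  have key : (aeval (fun i => ∑ j, C ((M * N) i j) * X j : Fin 3 → MvPolynomial (Fin 3) ℂ) :
      MvPolynomial (Fin 3) ℂ →ₐ[ℂ] MvPolynomial (Fin 3) ℂ) =
      (aeval (fun i => ∑ j, C (N i j) * X j : Fin 3 → MvPolynomial (Fin 3) ℂ)).comp
        (aeval (fun i => ∑ j, C (M i j) * X j : Fin 3 → MvPolynomial (Fin 3) ℂ)) := by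
    apply algHom_ext
    intro i
    simp only [AlgHom.comp_apply, aeval_X, map_sum, map_mul, Fin.sum_univ_three,
      Matrix.mul_apply, map_add, algHom_C, algebraMap_eq]
    ring
  exact DFunLike.congr_fun key Q

lemma subst3_add (M : Matrix (Fin 3) (Fin 3) ℂ) (P Q : MvPolynomial (Fin 3) ℂ) :
    subst3 M (P + Q) = subst3 M P + subst3 M Q := by
  simp only [subst3, map_add]

lemma subst3_C_mul (M : Matrix (Fin 3) (Fin 3) ℂ) (a : ℂ) (Q : MvPolynomial (Fin 3) ℂ) :
    subst3 M (C a * Q) = C a * subst3 M Q := by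
  simp only [subst3, map_mul, algHom_C, algebraMap_eq]

lemma pb3_mul (M N : Matrix (Fin 3) (Fin 3) ℂ) (P : Fin 3 → MvPolynomial (Fin 3) ℂ) :
    pb3 (M * N) P = pb3 N (pb3 M P) := by
  funext i
  simp only [pb3, subst3_mul, Fin.sum_univ_three, Matrix.mul_apply, subst3_add, subst3_C_mul]
  simp only [C_add, C_mul]
  ring

/-- **Characterization of the Fermat foliation.**
Let `d ≥ 2` and let `F` be a degree-`d` foliation of `ℙ²(ℂ)` given by
`Ω = p dx + q dy + r dz` (`p, q, r` homogeneous of degree `d+1`, `xp + yq + zr = 0`,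
`gcd(p,q,r) = 1`).  If `F` has three non-collinear radial singularities of maximal
order `d − 1` — i.e. there is `S ∈ GL₃(ℂ)` such that for `Ω' = S*Ω` the three
coordinate points are radial singularities of maximal order, as expressed by the
order-of-vanishing conditions (i)–(iii) in the three standard charts — then `F` is
linearly conjugate to the degree-`d` Fermat foliation. -/
theorem stmt_8 (d : ℕ) (hd : 2 ≤ d) (Ω : Fin 3 → MvPolynomial (Fin 3) ℂ)
    (hhom : ∀ i, (Ω i).IsHomogeneous (d + 1))
    (heuler : X 0 * Ω 0 + X 1 * Ω 1 + X 2 * Ω 2 = 0)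
    (hgcd : ∀ h : MvPolynomial (Fin 3) ℂ, (∀ i, h ∣ Ω i) → IsUnit h)
    (hS : ∃ S : Matrix (Fin 3) (Fin 3) ℂ, IsUnit S.det ∧
      radCond d (dhz (pb3 S Ω 0)) (dhz (pb3 S Ω 1)) (dhz (pb3 S Ω 2)) ∧
      radCond d (dhy (pb3 S Ω 0)) (dhy (pb3 S Ω 2)) (dhy (pb3 S Ω 1)) ∧
      radCond d (dhx (pb3 S Ω 1)) (dhx (pb3 S Ω 2)) (dhx (pb3 S Ω 0))) :
    ∃ (T : Matrix (Fin 3) (Fin 3) ℂ) (c : ℂ), IsUnit T.det ∧ c ≠ 0 ∧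
      pb3 T Ω = fun i => C c * FermatForm d i := by
  obtain ⟨S, hSdet, ⟨-, -, hz1, hz2, -⟩, ⟨-, -, hy1, hy2, -⟩, ⟨-, -, hx1, hx2, -⟩⟩ := hS
  have hP := pb3_hom S (d + 1) Ω hhom
  have he := pb3_euler S Ω heuler
  have hmul := pb3_mul S
  generalize hPdef : pb3 S Ω = P at *
  have hv : ∀ i m, m i ≠ 0 → coeff m (P i) = 0 := by
    rw [dhz_eq] at hz2
    rw [dhy_eq] at hy2
    rw [dhx_eq] at hx2
    intro i m hm
    fin_cases i
    · exact dh_vanish 0 (d + 1) _ (hP 0) hx2 m hm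
    · exact dh_vanish 1 (d + 1) _ (hP 1) hy2 m hm
    · exact dh_vanish 2 (d + 1) _ (hP 2) hz2 m hm
  have e0 := struct_form d hd P hP hv 0 1 2 (by decide) (by decide) (by decide)
    (by linear_combination he)
  have e1 := struct_form d hd P hP hv 1 2 0 (by decide) (by decide) (by decide)
    (by linear_combination he)
  have e2 := struct_form d hd P hP hv 2 0 1 (by decide) (by decide) (by decide)
    (by linear_combination he)
  rw [struct_rel d hd P hv 0 2 1 (by decide) (by decide) (by decide)
    (by linear_combination he)] at e0
  rw [struct_rel d hd P hv 1 0 2 (by decide) (by decide) (by decide)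
    (by linear_combination he)] at e1
  rw [struct_rel d hd P hv 2 1 0 (by decide) (by decide) (by decide)
    (by linear_combination he)] at e2
  generalize cf d (P 0) 1 2 = a at *
  generalize cf d (P 1) 2 0 = c at *
  generalize cf d (P 2) 0 1 = f at *
  have hd0 : d ≠ 0 := by omega
  have hc : c ≠ 0 := by
    rintro rfl
    rw [e0, e1] at hz1
    simp [dhz, comp_one_zero d hd, hd0] at hz1
  have ha : a ≠ 0 := by
    rintro rfl
    rw [e0, e2] at hy1
    simp [dhy, comp_one_zero d hd, hd0] at hy1
  have hf : f ≠ 0 := by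
    rintro rfl
    rw [e1, e2] at hx1
    simp [dhx, comp_one_zero d hd, hd0] at hx1
  obtain ⟨n, rfl⟩ : ∃ n, d = n + 2 := ⟨d - 2, by omega⟩
  have root : ∀ t : ℂ, t ≠ 0 → ∃ u : ℂ, t * u ^ (n + 1) = 1 ∧ u ≠ 0 := by
    intro t ht
    obtain ⟨u, hu⟩ := IsAlgClosed.exists_pow_nat_eq t⁻¹ (n := n + 1) (by omega)
    have h : t * u ^ (n + 1) = 1 := by rw [hu, mul_inv_cancel₀ ht]
    refine ⟨u, h, ?_⟩
    rintro rfl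
    simp at h
  obtain ⟨α, hα, hα0⟩ := root f hf
  obtain ⟨β, hβ, hβ0⟩ := root a ha
  obtain ⟨γ, hγ, hγ0⟩ := root c hc
  refine ⟨S * Matrix.diagonal ![α, β, γ], α * β * γ, ?_, ?_, ?_⟩
  · rw [Matrix.det_mul, Matrix.det_diagonal, Fin.prod_univ_three]
    refine hSdet.mul (IsUnit.mk0 _ ?_)
    simp [hα0, hβ0, hγ0]
  · simp [hα0, hβ0, hγ0]
  rw [hmul, hPdef]
  have hα' := congrArg (C (σ := Fin 3)) hα
  have hβ' := congrArg (C (σ := Fin 3)) hβ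
  have hγ' := congrArg (C (σ := Fin 3)) hγ
  simp only [map_mul, map_pow, map_one] at hα' hβ' hγ'
  funext i
  fin_cases i
  · simp [pb3, subst3, Fin.sum_univ_three, FermatForm, e0, Matrix.diagonal_apply, algebraMap_eq]
    linear_combination (C α * C β * C γ * X 1 ^ (n+2) * X 2) * hβ'
      - (C α * C β * C γ * X 2 ^ (n+2) * X 1) * hγ'
  · simp [pb3, subst3, Fin.sum_univ_three, FermatForm, e1, Matrix.diagonal_apply, algebraMap_eq]
    linear_combination (C α * C β * C γ * X 2 ^ (n+2) * X 0) * hγ'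
      - (C α * C β * C γ * X 0 ^ (n+2) * X 2) * hα'
  · simp [pb3, subst3, Fin.sum_univ_three, FermatForm, e2, Matrix.diagonal_apply, algebraMap_eq]
    linear_combination (C α * C β * C γ * X 0 ^ (n+2) * X 1) * hα'
      - (C α * C β * C γ * X 1 ^ (n+2) * X 0) * hβ'
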